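/- Let R be a commutative ring (in particular, any field), n ≥ 1, and let i, p be integers with 1 ≤ i ≤ p ≤ n. For any functions u, v : Fin (i−1) → Fin n, the following identity holds in A: Σ_{k=1}^{n} Σ_{j} M(u ⧺ k ⧺ j ; v ⧺ k ⧺ j) = (p − i + 1) · Σ_{j'} M(u ⧺ j' ; v ⧺ j'), where the inner sum on the left is over all strictly increasing functions j : Fin (p−i) → Fin n, the sum on the right is over all strictly increasing functions j' : Fin (p−i+1) → Fin n, and u ⧺ k ⧺ j denotes the row-index tuple obtained by concatenating u, the single index k, and j (similarly for columns). (This identity shows that the span V_{i−1,p} of the left-hand sums is contained in the span V_{i,p} whenever the coefficient p−i+1 is invertible.) -/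

import Mathlib

open MvPolynomial

/-- The minor `M(a ; b)` of the generic `n × n` matrix: the determinant of the `r × r`
matrix whose `(s,t)` entry is the variable `Φ_{a s, b t}`. -/
noncomputable def genericMinor (R : Type*) [CommRing R] {n r : ℕ}
    (a b : Fin r → Fin n) : MvPolynomial (Fin n × Fin n) R :=
  Matrix.det (Matrix.of fun s t => (X (a s, b t) : MvPolynomial (Fin n × Fin n) R))

theorem genericMinor_reindex (R : Type*) [CommRing R] {n r r' : ℕ} (e : Fin r' ≃ Fin r)
    (a b : Fin r → Fin n) : genericMinor R (a ∘ e) (b ∘ e) = genericMinor R a b := by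
  unfold genericMinor
  rw [← Matrix.det_submatrix_equiv_self e]
  rfl

theorem append_comp_perm {α : Type*} {l r : ℕ} (u : Fin l → α) (j : Fin r → α)
    (σ : Equiv.Perm (Fin r)) :
    Fin.append u (j ∘ σ) = Fin.append u j ∘
      ((finSumFinEquiv.symm.trans (Equiv.sumCongr (Equiv.refl _) σ)).trans finSumFinEquiv) := by
  funext x
  refine Fin.addCases (fun t => ?_) (fun t => ?_) x <;> simp

theorem append_assoc_cons {α : Type*} {l m : ℕ} (u : Fin l → α) (k : α) (j : Fin m → α) :
    ∃ h : l + 1 + m = l + (m + 1), Fin.append (Fin.append u (fun _ : Fin 1 => k)) j =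
      Fin.append u (Fin.cons k j : Fin (m + 1) → α) ∘ (finCongr h) := by
  refine ⟨by omega, ?_⟩
  funext x
  refine Fin.addCases (fun t => ?_) (fun t => ?_) x
  · refine Fin.addCases (fun s => ?_) (fun s => ?_) t
    · have : finCongr (by omega : l + 1 + m = l + (m + 1)) (Fin.castAdd m (Fin.castAdd 1 s))
        = Fin.castAdd (m + 1) s := by ext; simp
      simp only [Function.comp, this, Fin.append_left]
    · have : finCongr (by omega : l + 1 + m = l + (m + 1)) (Fin.castAdd m (Fin.natAdd l s))
        = Fin.natAdd l 0 := by ext; simp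
      simp only [Function.comp, this, Fin.append_left, Fin.append_right, Fin.cons_zero]
  · have : finCongr (by omega : l + 1 + m = l + (m + 1)) (Fin.natAdd (l + 1) t)
        = Fin.natAdd l t.succ := by ext; simp; omega
    simp only [Function.comp, this, Fin.append_right, Fin.cons_succ]

theorem genericMinor_assoc (R : Type*) [CommRing R] {n l m : ℕ} (u v : Fin l → Fin n)
    (k : Fin n) (j : Fin m → Fin n) :
    genericMinor R (Fin.append (Fin.append u (fun _ : Fin 1 => k)) j)
      (Fin.append (Fin.append v (fun _ : Fin 1 => k)) j) =
    genericMinor R (Fin.append u (Fin.cons k j : Fin (m + 1) → Fin n))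
      (Fin.append v (Fin.cons k j : Fin (m + 1) → Fin n)) := by
  obtain ⟨h, e1⟩ := append_assoc_cons u k j
  obtain ⟨_, e2⟩ := append_assoc_cons v k j
  rw [e1, e2, genericMinor_reindex]

theorem range_removeNth {α : Type*} {m : ℕ} (s : Fin (m + 1)) (f : Fin (m + 1) → α) :
    insert (f s) (Set.range (s.removeNth f)) = Set.range f := by
  ext x
  constructor
  · rintro (rfl | ⟨t, rfl⟩)
    · exact ⟨s, rfl⟩
    · exact ⟨s.succAbove t, rfl⟩
  · rintro ⟨t, rfl⟩
    rcases Fin.eq_self_or_eq_succAbove s t with rfl | ⟨t, rfl⟩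
    · exact Or.inl rfl
    · exact Or.inr ⟨t, rfl⟩

open scoped Classical in
theorem sum_symm_aux {A : Type*} [CommRing A] {n m : ℕ} (F : (Fin (m + 1) → Fin n) → A)
    (hF : ∀ (j : Fin (m + 1) → Fin n) (σ : Equiv.Perm (Fin (m + 1))), F (j ∘ σ) = F j)
    (h0 : ∀ j : Fin (m + 1) → Fin n, ¬ Function.Injective j → F j = 0) :
    (∑ k : Fin n, ∑ j ∈ Finset.univ.filter (fun j : Fin m → Fin n => StrictMono j),
      F (Fin.cons k j)) =
    (m + 1) • ∑ j ∈ Finset.univ.filter (fun j : Fin (m + 1) → Fin n => StrictMono j), F j := by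
  have hmono : ∀ (s : Fin (m + 1)) (f : Fin (m + 1) → Fin n), StrictMono f →
      StrictMono (s.removeNth f) := fun s f hf => hf.comp (Fin.strictMono_succAbove s)
  have hR : (m + 1) • ∑ j ∈ Finset.univ.filter (fun j : Fin (m + 1) → Fin n => StrictMono j), F j
      = ∑ x ∈ (Finset.univ : Finset (Fin (m + 1))) ×ˢ
        Finset.univ.filter (fun j : Fin (m + 1) → Fin n => StrictMono j), F x.2 := by
    rw [Finset.sum_product]; simp
  rw [hR, ← Finset.sum_product']
  symm
  refine Finset.sum_bij_ne_zero (fun x _ _ => (x.2 x.1, x.1.removeNth x.2)) ?_ ?_ ?_ ?_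
  · rintro ⟨s, f⟩ h _
    simp only [Finset.mem_product, Finset.mem_univ, Finset.mem_filter, true_and] at h ⊢
    exact hmono s f h
  · rintro ⟨s, f⟩ h _ ⟨s', f'⟩ h' _ he
    simp only [Finset.mem_product, Finset.mem_univ, Finset.mem_filter, true_and] at h h'
    simp only [Prod.mk.injEq] at he
    obtain ⟨e1, e2⟩ := he
    have : f = f' := by
      refine (StrictMono.range_inj h h').1 ?_
      rw [← range_removeNth s f, ← range_removeNth s' f', e1, e2]
    subst this
    rw [h.injective e1]
  · rintro ⟨k, j⟩ h hne
    simp only [Finset.mem_product, Finset.mem_univ, Finset.mem_filter, true_and] at h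
    have hinj : Function.Injective (Fin.cons k j : Fin (m + 1) → Fin n) := by
      by_contra hc
      exact hne (h0 _ hc)
    have hk : k ∉ Set.range j := (Fin.cons_injective_iff.1 hinj).1
    have hcard : (Finset.univ.image (Fin.cons k j : Fin (m + 1) → Fin n)).card = m + 1 := by
      rw [Finset.card_image_of_injective _ hinj]; simp
    let f : Fin (m + 1) → Fin n := Finset.orderEmbOfFin _ hcard
    have hf : StrictMono f := (Finset.orderEmbOfFin _ hcard).strictMono
    have hr : Set.range f = insert k (Set.range j) := by
      have := Finset.range_orderEmbOfFin _ hcard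
      rw [show Set.range f = _ from this]
      simp [Fin.range_cons]
    obtain ⟨s, hs⟩ : k ∈ Set.range f := by rw [hr]; exact Set.mem_insert _ _
    have hj : s.removeNth f = j := by
      refine (StrictMono.range_inj (hmono s f hf) h).1 ?_
      have h1 := range_removeNth s f
      rw [hr, hs] at h1
      have h2 : k ∉ Set.range (s.removeNth f) := by
        rintro ⟨t, ht⟩
        exact Fin.succAbove_ne s t (hf.injective (ht.trans hs.symm))
      rw [← Set.insert_sdiff_self_of_notMem h2, h1, Set.insert_sdiff_self_of_notMem hk]
    have hc : (Fin.cons k j : Fin (m + 1) → Fin n) = f ∘ s.cycleRange.symm := by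
      funext t
      rw [Function.comp, ← Fin.insertNth_apply_cycleRange_symm s k j t, ← hs, ← hj,
        Fin.insertNth_self_removeNth]
    refine ⟨(s, f), ?_, ?_, ?_⟩
    · simpa using hf
    · change F (Fin.cons k j) ≠ 0 at hne
      rwa [hc, hF] at hne
    · simp [hs, hj]
  · rintro ⟨s, f⟩ h _
    have hc : (Fin.cons (f s) (s.removeNth f) : Fin (m + 1) → Fin n)
        = f ∘ s.cycleRange.symm := by
      funext t
      rw [Function.comp, ← Fin.insertNth_apply_cycleRange_symm s (f s) (s.removeNth f) t,
        Fin.insertNth_self_removeNth]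
    change F f = F (Fin.cons (f s) (s.removeNth f))
    rw [hc, hF]

open scoped Classical in
theorem sum_trace_minor_identity (R : Type*) [CommRing R]
    (n i p : ℕ) (hn : 1 ≤ n) (hi : 1 ≤ i) (hip : i ≤ p) (hpn : p ≤ n)
    (u v : Fin (i - 1) → Fin n) :
    (∑ k : Fin n,
      ∑ j ∈ Finset.univ.filter (fun j : Fin (p - i) → Fin n => StrictMono j),
        genericMinor R (Fin.append (Fin.append u (fun _ : Fin 1 => k)) j)
                       (Fin.append (Fin.append v (fun _ : Fin 1 => k)) j))
    = (p - i + 1) •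
      ∑ j' ∈ Finset.univ.filter (fun j' : Fin (p - i + 1) → Fin n => StrictMono j'),
        genericMinor R (Fin.append u j') (Fin.append v j') := by

  simp only [genericMinor_assoc]
  refine sum_symm_aux
    (fun j => genericMinor R (Fin.append u j) (Fin.append v j)) ?_ ?_
  · intro j σ
    simp only [append_comp_perm, genericMinor_reindex]
  · intro j hj
    obtain ⟨a, b, hab, hne⟩ := Function.not_injective_iff.1 hj
    unfold genericMinor
    refine Matrix.det_zero_of_row_eq (i := Fin.natAdd _ a) (j := Fin.natAdd _ b) ?_ ?_
    · intro h
      exact hne (by simpa using h)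
    · funext t
      simp [hab]
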